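/- Let ℓ, r, m ∈ ℕ. If splitter wins the variant of the radius-r splitter game on a graph G in which she may delete a set of at most m vertices in each round and the game lasts at most ℓ rounds, then splitter wins the simple (ℓ·m)-round radius-r splitter game on G. -/

import Mathlib

open SimpleGraph

variable {V : Type} {W : Type}

/-- The set of vertices at distance at most `r` from `v` in `G`. -/
def ball (G : SimpleGraph V) (r : ℕ) (v : V) : Set V :=
  {u | ∃ p : G.Walk v u, p.length ≤ r}

/-- `G` has radius at most `r`. -/
def hasRadiusLE (G : SimpleGraph V) (r : ℕ) : Prop :=
  ∃ u : V, ∀ v : V, ∃ p : G.Walk u v, p.length ≤ r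

/-- `H` is a depth-`r` minor of `G`: there are pairwise disjoint branch sets of
radius at most `r`, one for each vertex of `H`, connected appropriately. -/
def IsDepthMinor (r : ℕ) (H : SimpleGraph W) (G : SimpleGraph V) : Prop :=
  ∃ φ : W → Set V,
    (∀ w : W, hasRadiusLE (G.induce (φ w)) r) ∧
    (Pairwise fun w w' => Disjoint (φ w) (φ w')) ∧
    (∀ a b : W, H.Adj a b → ∃ u ∈ φ a, ∃ v ∈ φ b, G.Adj u v)

/-- `H` is a minor of `G` (no restriction on the radius of branch sets). -/
def IsMinorOf (H : SimpleGraph W) (G : SimpleGraph V) : Prop :=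
  ∃ φ : W → Set V,
    (∀ w : W, (G.induce (φ w)).Connected) ∧
    (Pairwise fun w w' => Disjoint (φ w) (φ w')) ∧
    (∀ a b : W, H.Adj a b → ∃ u ∈ φ a, ∃ v ∈ φ b, G.Adj u v)

/-- A bundled finite graph. -/
structure FGraph : Type 1 where
  V : Type
  [fintypeV : Fintype V]
  G : SimpleGraph V

attribute [instance] FGraph.fintypeV

/-- A class of graphs is nowhere dense if for every `r` there is `m` such that
`K_m` is not a depth-`r` minor of any member. -/
def NowhereDense (C : Set FGraph) : Prop :=
  ∀ r : ℕ, ∃ m : ℕ, ∀ G ∈ C, ¬ IsDepthMinor r (⊤ : SimpleGraph (Fin m)) G.G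

/-- A class of graphs has bounded expansion if for every `r` the edge density of
depth-`r` minors of members is bounded. -/
def BoundedExpansion (C : Set FGraph) : Prop :=
  ∀ r : ℕ, ∃ d : ℝ, ∀ G ∈ C, ∀ (n : ℕ) (H : SimpleGraph (Fin n)),
    IsDepthMinor r H G.G → (H.edgeSet.ncard : ℝ) / (n : ℝ) ≤ d

/-- `H` is (isomorphic to) a subgraph of `G`. -/
def IsSubgraphOf (H G : FGraph) : Prop :=
  ∃ f : H.V → G.V, Function.Injective f ∧ ∀ a b : H.V, H.G.Adj a b → G.G.Adj (f a) (f b)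

/-- `N_r^{G-S}(v)`, the ball of radius `r` around `v` in `G - S`, as a subset of `V`. -/
def ballAvoiding (G : SimpleGraph V) (S : Set V) (r : ℕ) (v : V) : Set V :=
  {u | ∃ p : G.Walk v u, p.length ≤ r ∧ ∀ x ∈ p.support, x ∉ S}

/-- `B` is distance-`r` independent in `G - S`: distinct vertices of `B` have
distance greater than `r` in `G - S`. -/
def DistIndepIn (G : SimpleGraph V) (S : Set V) (r : ℕ) (B : Set V) : Prop :=
  ∀ u ∈ B, ∀ v ∈ B, u ≠ v →
    ∀ p : G.Walk u v, (∀ x ∈ p.support, x ∉ S) → r < p.length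

/-- Uniform quasi-wideness. -/
def UniformlyQuasiWide (C : Set FGraph) : Prop :=
  ∀ r : ℕ, ∃ s : ℕ, ∀ m : ℕ, ∃ N : ℕ, ∀ G ∈ C, ∀ A : Set G.V,
    N ≤ A.ncard → ∃ S : Set G.V, S.ncard ≤ s ∧
      ∃ B ⊆ A \ S, m ≤ B.ncard ∧ DistIndepIn G.G S r B

/-- Splitter wins the simple `ℓ`-round radius-`r` splitter game on `G`. -/
def SplitterWins (r : ℕ) : (ℓ : ℕ) → (V : Type) → SimpleGraph V → Prop
  | 0, V, _ => IsEmpty V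
  | (ℓ + 1), _, G =>
      ∀ C : G.Subgraph, hasRadiusLE C.coe r →
        ∃ w ∈ C.verts, SplitterWins r ℓ _ ((C.deleteVerts {w}).coe)

/-- Splitter wins the `ℓ`-round treedepth game on `G`. -/
def TDSplitterWins : (ℓ : ℕ) → (V : Type) → SimpleGraph V → Prop
  | 0, V, _ => IsEmpty V
  | (ℓ + 1), _, G =>
      ∀ c : G.ConnectedComponent, ∃ w ∈ c.supp,
        TDSplitterWins ℓ _ (G.induce (c.supp \ {w}))

/-- Splitter wins the variant of the `ℓ`-round radius-`r` splitter game in which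
she may delete up to `m` vertices per round. -/
def SplitterWinsSets (r m : ℕ) : (ℓ : ℕ) → (V : Type) → SimpleGraph V → Prop
  | 0, V, _ => IsEmpty V
  | (ℓ + 1), _, G =>
      ∀ C : G.Subgraph, hasRadiusLE C.coe r →
        ∃ W ⊆ C.verts, W.ncard ≤ m ∧ SplitterWinsSets r m ℓ _ ((C.deleteVerts W).coe)

/-- `le` is the ancestor order of a rooted forest: a partial order in which the
set of ancestors of any element is a chain. -/
def IsForestOrder (le : V → V → Prop) : Prop :=
  (∀ v, le v v) ∧ (∀ u v w, le u v → le v w → le u w) ∧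
  (∀ u v, le u v → le v u → u = v) ∧
  (∀ v u w, le u v → le w v → le u w ∨ le w u)

/-- `G` has treedepth at most `ℓ`: there is a rooted forest of depth at most `ℓ`
on `V(G)` such that every edge joins an ancestor-descendant pair. -/
def TreedepthLE (G : SimpleGraph V) (ℓ : ℕ) : Prop :=
  ∃ le : V → V → Prop, IsForestOrder le ∧
    (∀ u v, G.Adj u v → le u v ∨ le v u) ∧
    ∀ v, ({u | le u v}).ncard ≤ ℓ

/-- The treedepth of `G`. -/
noncomputable def treedepth (G : SimpleGraph V) : ℕ := sInf {ℓ | TreedepthLE G ℓ}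

/-- `WReach G le r v`: the set of vertices weakly `r`-reachable from `v`
with respect to the linear order `le`. -/
def WReach (G : SimpleGraph V) (le : V → V → Prop) (r : ℕ) (v : V) : Set V :=
  {u | le u v ∧ ∃ p : G.Walk u v, p.IsPath ∧ p.length ≤ r ∧
    ∀ x ∈ p.support, x ≠ u → x ≠ v → le u x ∧ u ≠ x}

/-- `WReachInf G le v`: the set of vertices weakly reachable from `v`
with respect to the linear order `le` (no bound on path length). -/
def WReachInf (G : SimpleGraph V) (le : V → V → Prop) (v : V) : Set V :=
  {u | le u v ∧ ∃ p : G.Walk u v, p.IsPath ∧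
    ∀ x ∈ p.support, x ≠ u → x ≠ v → le u x ∧ u ≠ x}

/-- The weak `r`-coloring number of `G`. -/
noncomputable def wcol (G : SimpleGraph V) (r : ℕ) : ℕ :=
  sInf {k | ∃ le : V → V → Prop, IsLinearOrder V le ∧ ∀ v, (WReach G le r v).ncard ≤ k}

/-- The coloring number of `G`: the least `k` such that some linear order has
every vertex with at most `k - 1` smaller neighbors. -/
noncomputable def coloringNumber (G : SimpleGraph V) : ℕ :=
  sInf {k | ∃ le : V → V → Prop, IsLinearOrder V le ∧
    ∀ v, ({u | G.Adj u v ∧ le u v ∧ u ≠ v}).ncard + 1 ≤ k}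

/-- `X` is an `r`-neighborhood cover of `G` with clusters of radius at most `ρ`:
each cluster induces a connected subgraph of radius at most `ρ`, and every
`r`-ball is contained in some cluster. -/
def IsNbhdCover (G : SimpleGraph V) (r ρ : ℕ) (X : Set (Set V)) : Prop :=
  (∀ C ∈ X, hasRadiusLE (G.induce C) ρ) ∧ ∀ v : V, ∃ C ∈ X, ball G r v ⊆ C

/-- The cluster `X_r[G,π,u] = {w : u ∈ WReach_r[G,π,w]}`. -/
def XCluster (G : SimpleGraph V) (le : V → V → Prop) (r : ℕ) (u : V) : Set V :=
  {w | u ∈ WReach G le r w}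

/-- The smaller endpoint of an edge. -/
def sym2Min {n : ℕ} (e : Sym2 (Fin n)) : Fin n :=
  Sym2.lift ⟨fun a b => min a b, fun _ _ => min_comm _ _⟩ e

/-- The larger endpoint of an edge. -/
def sym2Max {n : ℕ} (e : Sym2 (Fin n)) : Fin n :=
  Sym2.lift ⟨fun a b => max a b, fun _ _ => max_comm _ _⟩ e

/-- The relation generating the `r`-subdivision of `G`. -/
def SubdivRel {n : ℕ} (r : ℕ) (G : SimpleGraph (Fin n)) :
    (Fin n ⊕ (G.edgeSet × Fin r)) → (Fin n ⊕ (G.edgeSet × Fin r)) → Prop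
  | Sum.inl a, Sum.inl b => r = 0 ∧ G.Adj a b
  | Sum.inl a, Sum.inr ei => ((ei.2 : ℕ) = 0 ∧ a = sym2Min ei.1.1) ∨
      ((ei.2 : ℕ) = r - 1 ∧ a = sym2Max ei.1.1)
  | Sum.inr ei, Sum.inr ej => ei.1 = ej.1 ∧ (ei.2 : ℕ) + 1 = (ej.2 : ℕ)
  | Sum.inr _, Sum.inl _ => False

/-- The `r`-subdivision of `G`: every edge is replaced by a path with `r`
internal vertices. -/
def Subdivision {n : ℕ} (r : ℕ) (G : SimpleGraph (Fin n)) :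
    SimpleGraph ((Fin n) ⊕ (G.edgeSet × Fin r)) :=
  SimpleGraph.fromRel (SubdivRel r G)

theorem hasRadiusLE_of_surjective {A B : Type} {G : SimpleGraph A} {H : SimpleGraph B}
    (f : G →g H) (hf : Function.Surjective f) {r : ℕ} (h : hasRadiusLE G r) :
    hasRadiusLE H r := by
  obtain ⟨u, hu⟩ := h
  refine ⟨f u, fun v => ?_⟩
  obtain ⟨a, rfl⟩ := hf v
  obtain ⟨p, hp⟩ := hu a
  exact ⟨p.map f, by simpa using hp⟩

theorem hasRadiusLE_map {A B : Type} {G : SimpleGraph A} {H : SimpleGraph B}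
    (f : G →g H) (C : G.Subgraph) {r : ℕ} (h : hasRadiusLE C.coe r) :
    hasRadiusLE (C.map f).coe r := by
  refine hasRadiusLE_of_surjective (G := C.coe)
    ⟨fun x => ⟨f x.1, Set.mem_image_of_mem f x.2⟩, ?_⟩ ?_ h
  · intro a b hab
    exact ⟨a.1, b.1, hab, rfl, rfl⟩
  · rintro ⟨_, a, ha, rfl⟩
    exact ⟨⟨a, ha⟩, rfl⟩

/-- The map induced by `f` on the subgraphs left after deleting corresponding vertices. -/
def deleteVertsMap {A B : Type} {G : SimpleGraph A} {H : SimpleGraph B}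
    (f : G →g H) (hf : Function.Injective f) (C : G.Subgraph) (S : Set A) :
    (C.deleteVerts S).coe →g ((C.map f).deleteVerts (f '' S)).coe where
  toFun x := ⟨f x.1, Set.mem_image_of_mem f x.2.1, fun h => x.2.2 ((hf.mem_set_image).1 h)⟩
  map_rel' := by
    rintro ⟨a, ha⟩ ⟨b, hb⟩ hab
    have hab' := (Subgraph.deleteVerts_adj).1 hab
    refine (Subgraph.deleteVerts_adj).2 ⟨Set.mem_image_of_mem f ha.1,
      fun h => ha.2 ((hf.mem_set_image).1 h), Set.mem_image_of_mem f hb.1,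
      fun h => hb.2 ((hf.mem_set_image).1 h), a, b, hab'.2.2.2.2, rfl, rfl⟩

theorem deleteVertsMap_injective {A B : Type} {G : SimpleGraph A} {H : SimpleGraph B}
    (f : G →g H) (hf : Function.Injective f) (C : G.Subgraph) (S : Set A) :
    Function.Injective (deleteVertsMap f hf C S) := fun _ _ hxy =>
  Subtype.ext (hf (congrArg Subtype.val hxy))

theorem SplitterWins.of_injective {r k : ℕ} {A B : Type} {G : SimpleGraph A}
    {H : SimpleGraph B} (f : G →g H) (hf : Function.Injective f)
    (h : SplitterWins r k B H) : SplitterWins r k A G := by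
  induction k generalizing A B with
  | zero => exact ⟨fun a => IsEmpty.false (self := h) (f a)⟩
  | succ k ih =>
    intro C hC
    obtain ⟨_, ⟨w, hw, rfl⟩, hwin⟩ := h (C.map f) (hasRadiusLE_map f C hC)
    refine ⟨w, hw, ?_⟩
    rw [← Set.image_singleton] at hwin
    exact ih (deleteVertsMap f hf C {w}) (deleteVertsMap_injective f hf C {w}) hwin

theorem SplitterWinsSets.of_injective {r m k : ℕ} {A B : Type} [Finite A]
    {G : SimpleGraph A} {H : SimpleGraph B} (f : G →g H) (hf : Function.Injective f)
    (h : SplitterWinsSets r m k B H) : SplitterWinsSets r m k A G := by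
  induction k generalizing A B with
  | zero => exact ⟨fun a => IsEmpty.false (self := h) (f a)⟩
  | succ k ih =>
    intro C hC
    obtain ⟨S, hS, hcard, hwin⟩ := h (C.map f) (hasRadiusLE_map f C hC)
    obtain ⟨T, hT, rfl⟩ := (Set.subset_image_iff).1 hS
    rw [Set.ncard_image_of_injective _ hf] at hcard
    exact ⟨T, hT, hcard, ih (deleteVertsMap f hf C T) (deleteVertsMap_injective f hf C T) hwin⟩

/-- To win on `G` it suffices to win on all of its subgraphs of radius at most `r`. -/
theorem SplitterWins.of_forall_subgraph {r k : ℕ} {A : Type} {G : SimpleGraph A}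
    (h : ∀ C : G.Subgraph, hasRadiusLE C.coe r → SplitterWins r k _ C.coe) :
    SplitterWins r k A G := by
  cases k with
  | zero =>
    refine ⟨fun a => ?_⟩
    have hrad : hasRadiusLE (G.singletonSubgraph a).coe r := by
      refine ⟨⟨a, rfl⟩, ?_⟩
      rintro ⟨_, rfl⟩
      exact ⟨Walk.nil, Nat.zero_le _⟩
    exact IsEmpty.false (self := h _ hrad) ⟨a, rfl⟩
  | succ k =>
    intro C hC
    obtain ⟨w, -, hwin⟩ := h C hC ⊤ (hasRadiusLE_of_surjective
      (Subgraph.topIso (G := C.coe)).symm.toHom (Subgraph.topIso (G := C.coe)).symm.surjective hC)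
    refine ⟨w.1, w.2, SplitterWins.of_injective
      ⟨fun x => ⟨⟨x.1, x.2.1⟩, trivial, fun hx => x.2.2 (congrArg Subtype.val hx)⟩, ?_⟩ ?_ hwin⟩
    · rintro ⟨a, ha⟩ ⟨b, hb⟩ hab
      have hab' := (Subgraph.deleteVerts_adj).1 hab
      exact (Subgraph.deleteVerts_adj).2 ⟨trivial, fun hx => ha.2 (congrArg Subtype.val hx),
        trivial, fun hx => hb.2 (congrArg Subtype.val hx), hab'.2.2.2.2⟩
    · intro x y hxy
      exact Subtype.ext (congrArg (fun z => z.1.1) hxy)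

/-- Deleting at most `k` vertices can be simulated by `k` additional simple rounds. -/
theorem SplitterWins.of_induce_compl {r n k : ℕ} {A : Type} {G : SimpleGraph A} {S : Set A}
    (hfin : S.Finite) (hcard : S.ncard ≤ k) (h : SplitterWins r n _ (G.induce Sᶜ)) :
    SplitterWins r (n + k) A G := by
  induction k generalizing A with
  | zero =>
    obtain rfl := (Set.ncard_eq_zero hfin).1 (Nat.le_zero.1 hcard)
    exact SplitterWins.of_injective (H := G.induce (∅ : Set A)ᶜ)
      ⟨fun a => ⟨a, fun ha => ha⟩, fun hab => hab⟩ (fun a b hab => congrArg Subtype.val hab) h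
  | succ k ih =>
    intro C hC
    obtain ⟨w, hw, hwS⟩ : ∃ w ∈ C.verts, (S ∩ (C.verts \ {w})).ncard ≤ k := by
      by_cases hne : (S ∩ C.verts).Nonempty
      · obtain ⟨w, hwS, hw⟩ := hne
        refine ⟨w, hw, ?_⟩
        have hlt : (S ∩ (C.verts \ {w})).ncard < S.ncard :=
          Set.ncard_lt_ncard ⟨fun x hx => hx.1, fun hx => (hx hwS).2.2 rfl⟩ hfin
        omega
      · obtain ⟨u, -⟩ := hC
        refine ⟨u.1, u.2, ?_⟩
        have : S ∩ (C.verts \ {u.1}) = ∅ :=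
          Set.eq_empty_of_forall_notMem fun x hx => hne ⟨x, hx.1, hx.2.1⟩
        simp [this]
    have himg : Subtype.val '' (Subtype.val ⁻¹' S : Set (C.deleteVerts {w}).verts) =
        S ∩ (C.verts \ {w}) := by
      rw [Subtype.image_preimage_coe, Set.inter_comm]
      rfl
    refine ⟨w, hw, ih (S := Subtype.val ⁻¹' S)
      (hfin.preimage Subtype.val_injective.injOn) ?_ ?_⟩
    · rw [← Set.ncard_image_of_injective _ Subtype.val_injective, himg]
      exact hwS
    · refine SplitterWins.of_injective ⟨fun x => ⟨x.1.1, x.2⟩, ?_⟩ ?_ h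
      · intro a b hab
        exact C.adj_sub ((Subgraph.deleteVerts_adj).1 hab).2.2.2.2
      · intro a b hab
        exact Subtype.ext (Subtype.ext (congrArg (fun z => z.1) hab))

/-- In a graph of radius at most `r`, every finite vertex set is contained in a finite set
inducing a graph of radius at most `r`. -/
theorem exists_finite_superset_hasRadiusLE {A : Type} {G : SimpleGraph A} {r : ℕ}
    (h : hasRadiusLE G r) {S : Set A} (hS : S.Finite) :
    ∃ T : Set A, T.Finite ∧ S ⊆ T ∧ hasRadiusLE (G.induce T) r := by
  obtain ⟨u, hu⟩ := h
  choose p hp using hu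
  have hsub : ∀ v ∈ insert u S, ∀ x ∈ (p v).support,
      x ∈ ⋃ v ∈ insert u S, {x | x ∈ (p v).support} := fun v hv x hx =>
    Set.mem_biUnion hv hx
  refine ⟨⋃ v ∈ insert u S, {x | x ∈ (p v).support},
    (hS.insert u).biUnion fun v _ => List.finite_toSet _,
    fun v hv => hsub v (Or.inr hv) v (p v).end_mem_support,
    ⟨u, hsub u (Or.inl rfl) u (p u).start_mem_support⟩, ?_⟩
  rintro ⟨x, hx⟩
  obtain ⟨v, hv, hxv⟩ := (Set.mem_iUnion₂).1 hx
  classical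
  refine ⟨((p v).takeUntil x hxv).induce _ fun y hy =>
    hsub v hv y ((p v).support_takeUntil_subset_support hxv hy), ?_⟩
  rw [← Walk.length_map (Embedding.induce _).toHom, Walk.map_induce]
  exact ((p v).length_takeUntil_le_length hxv).trans (hp v)

/-- Compactness: splitter wins on `G` as soon as she wins on all finite induced subgraphs. -/
theorem SplitterWins.of_forall_finite {r k : ℕ} {A : Type} {G : SimpleGraph A}
    (h : ∀ S : Set A, S.Finite → SplitterWins r k _ (G.induce S)) :
    SplitterWins r k A G := by
  induction k generalizing A with
  | zero =>
    exact ⟨fun a => IsEmpty.false (self := h {a} (Set.finite_singleton a)) ⟨a, rfl⟩⟩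
  | succ k ih =>
    intro C hC
    by_contra! hlose
    have hobs : ∀ w : C.verts, ∃ S : Set C.verts, S.Finite ∧ w ∉ S ∧
        ¬ SplitterWins r k _ (C.coe.induce S) := by
      intro w
      by_contra! hw
      refine hlose w.1 w.2 (ih fun S hS => ?_)
      have hmem : ∀ x ∈ S, (⟨x.1, x.2.1⟩ : C.verts) ∈
          (fun x : (C.deleteVerts {w.1}).verts => (⟨x.1, x.2.1⟩ : C.verts)) '' S :=
        fun x hx => ⟨x, hx, rfl⟩
      refine SplitterWins.of_injective ⟨fun x => ⟨⟨x.1.1, x.1.2.1⟩, hmem x.1 x.2⟩, ?_⟩ ?_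
        (hw _ (hS.image _) ?_)
      · intro a b hab
        exact ((Subgraph.deleteVerts_adj).1 hab).2.2.2.2
      · intro a b hab
        exact Subtype.ext (Subtype.ext (congrArg (fun z => z.1.1) hab))
      · rintro ⟨x, -, hx⟩
        exact x.2.2 (congrArg Subtype.val hx)
    choose s hsfin hsmem hslose using hobs
    obtain ⟨u, -⟩ := id hC
    obtain ⟨T, hTfin, hsub, hTrad⟩ := exists_finite_superset_hasRadiusLE hC
      ((hsfin u).union ((hsfin u).biUnion fun w _ => hsfin w))
    have hT : SplitterWins r (k + 1) _ (C.coe.induce T) :=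
      SplitterWins.of_injective (H := G.induce (Subtype.val '' T))
        ⟨fun x => ⟨x.1.1, x.1, x.2, rfl⟩, fun hab => C.adj_sub hab⟩
        (fun a b hab => Subtype.ext (Subtype.ext (congrArg (fun z => z.1) hab)))
        (h _ (hTfin.image _))
    obtain ⟨w, -, hwin⟩ := hT ⊤ (hasRadiusLE_of_surjective
      (Subgraph.topIso (G := C.coe.induce T)).symm.toHom
      (Subgraph.topIso (G := C.coe.induce T)).symm.surjective hTrad)
    have hsmall : ∀ S : Set C.verts, S ⊆ T → w.1 ∉ S →
        SplitterWins r k _ (C.coe.induce S) := by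
      intro S hST hwS
      have hne : ∀ x : S, (⟨x.1, hST x.2⟩ : T) ∉ ({w} : Set T) := fun x hx =>
        hwS (congrArg Subtype.val hx ▸ x.2)
      refine SplitterWins.of_injective
        ⟨fun x => ⟨⟨x.1, hST x.2⟩, trivial, hne x⟩, ?_⟩ ?_ hwin
      · intro a b hab
        exact (Subgraph.deleteVerts_adj).2 ⟨trivial, hne a, trivial, hne b, hab⟩
      · intro a b hab
        exact Subtype.ext (congrArg (fun z => z.1.1) hab)
    by_cases hw : w.1 ∈ s u
    · exact hslose w.1 (hsmall _ (fun x hx => hsub (Or.inr (Set.mem_biUnion hw hx))) (hsmem _))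
    · exact hslose u (hsmall _ (fun x hx => hsub (Or.inl hx)) hw)

theorem SplitterWinsSets.splitterWins_of_finite {r m k : ℕ} {A : Type} [Finite A]
    {G : SimpleGraph A} (h : SplitterWinsSets r m k A G) : SplitterWins r (k * m) A G := by
  induction k generalizing A with
  | zero => rw [Nat.zero_mul]; exact h
  | succ k ih =>
    rw [Nat.succ_mul]
    refine SplitterWins.of_forall_subgraph fun C hC => ?_
    obtain ⟨S, hS, hcard, hwin⟩ := h C hC
    refine SplitterWins.of_induce_compl (S := (Subtype.val ⁻¹' S : Set C.verts))
      (Set.toFinite _) ?_ (SplitterWins.of_injective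
        ⟨fun x => ⟨x.1.1, x.1.2, x.2⟩, ?_⟩ ?_ (ih hwin))
    · rwa [← Set.ncard_image_of_injective _ Subtype.val_injective, Subtype.image_preimage_coe,
        Set.inter_eq_right.2 hS]
    · intro a b hab
      exact (Subgraph.deleteVerts_adj).2 ⟨a.1.2, a.2, b.1.2, b.2, hab⟩
    · intro a b hab
      exact Subtype.ext (Subtype.ext (congrArg (fun z => z.1) hab))

/-- If splitter wins the `ℓ`-round radius-`r` game in which she may
delete up to `m` vertices per round, then she wins the simple `ℓ·m`-round
radius-`r` splitter game. -/
theorem stmt18 {V : Type} (G : SimpleGraph V) (ℓ r m : ℕ)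
    (h : SplitterWinsSets r m ℓ V G) :
    SplitterWins r (ℓ * m) V G := by
  refine SplitterWins.of_forall_finite fun S hS => ?_
  have : Finite S := hS
  exact (SplitterWinsSets.of_injective (Embedding.induce (G := G) S).toHom
    (Embedding.induce (G := G) S).injective h).splitterWins_of_finite
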